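/- arXiv:1311.3258 — 5 statements merged into one kernel-verified Lean document; each statement's English description precedes it below -/
import Mathlib

section
/- Let I be an at most countable index set and A = (a_{ij})_{i,j∈I} a real matrix. Let g_0(A) be the real Lie algebra with generators h_i, e_i, f_i (i ∈ I) and defining relations [h_i,h_j]=0, [h_i,e_k]=a_{ik}e_k, [h_i,f_k]=-a_{ik}f_k, [e_i,f_j]=δ_{ij}h_i. Then g_0(A) decomposes as a direct sum of vector spaces g_0(A) = n_0^- ⊕ h ⊕ n_0^+, where h = span{h_i : i∈I} is an abelian subalgebra with the images of the h_i as a basis, n_0^+ (the subalgebra generated by the e_i) is the free Lie algebra on the set {e_i}_{i∈I}, and n_0^- (the subalgebra generated by the f_i) is the free Lie algebra on {f_i}_{i∈I}; in particular the images of the elements e_i, f_i, h_i (i∈I) are linearly independent in g_0(A). -/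
/-!
Statement 0: triangular decomposition of the Lie algebra `g₀(A)` presented by the
Chevalley-type generators `hᵢ, eᵢ, fᵢ` and relations (R1)-(R4).
-/

open FreeLieAlgebra
open scoped Classical

/-- The generators of `g₀(A)`: `h i`, `e i`, `f i` for `i ∈ I`. -/
inductive GKMGen (I : Type) : Type
  | h (i : I)
  | e (i : I)
  | f (i : I)

variable (I : Type) (A : I → I → ℝ)

/-- The defining relation elements (R1)-(R4) inside the free Lie algebra. -/
def gkmRels : Set (FreeLieAlgebra ℝ (GKMGen I)) :=
  {x | ∃ i j : I, x = ⁅of ℝ (GKMGen.h i), of ℝ (GKMGen.h j)⁆} ∪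
  {x | ∃ i k : I, x = ⁅of ℝ (GKMGen.h i), of ℝ (GKMGen.e k)⁆ - A i k • of ℝ (GKMGen.e k)} ∪
  {x | ∃ i k : I, x = ⁅of ℝ (GKMGen.h i), of ℝ (GKMGen.f k)⁆ + A i k • of ℝ (GKMGen.f k)} ∪
  {x | ∃ i j : I, x = ⁅of ℝ (GKMGen.e i), of ℝ (GKMGen.f j)⁆ -
      (if i = j then of ℝ (GKMGen.h i) else 0)}

/-- `g₀(A)`, the quotient of the free Lie algebra by the ideal generated by the relations. -/
def gZero := FreeLieAlgebra ℝ (GKMGen I) ⧸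
  LieSubmodule.lieSpan ℝ (FreeLieAlgebra ℝ (GKMGen I)) (gkmRels I A)

noncomputable instance : LieRing (gZero I A) := by unfold gZero; infer_instance
noncomputable instance : LieAlgebra ℝ (gZero I A) := by unfold gZero; infer_instance

/-- The image of a free generator in `g₀(A)`. -/
noncomputable def gen (x : GKMGen I) : gZero I A :=
  LieSubmodule.Quotient.mk' _ (of ℝ x)

noncomputable def Egen (i : I) : gZero I A := gen I A (GKMGen.e i)
noncomputable def Fgen (i : I) : gZero I A := gen I A (GKMGen.f i)
noncomputable def Hgen (i : I) : gZero I A := gen I A (GKMGen.h i)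

/-- The abelian subalgebra `h`, the span of the `hᵢ`. -/
noncomputable def hPart : Submodule ℝ (gZero I A) := Submodule.span ℝ (Set.range (Hgen I A))

/-- The subalgebra generated by the `eᵢ`. -/
noncomputable def nPlus : LieSubalgebra ℝ (gZero I A) :=
  LieSubalgebra.lieSpan ℝ _ (Set.range (Egen I A))

/-- The subalgebra generated by the `fᵢ`. -/
noncomputable def nMinus : LieSubalgebra ℝ (gZero I A) :=
  LieSubalgebra.lieSpan ℝ _ (Set.range (Fgen I A))

/-- The canonical Lie algebra map from the free Lie algebra on `I` sending the `i`-th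
generator to `eᵢ`. -/
noncomputable def eCanon : FreeLieAlgebra ℝ I →ₗ⁅ℝ⁆ gZero I A :=
  FreeLieAlgebra.lift ℝ (Egen I A)

/-- The canonical Lie algebra map from the free Lie algebra on `I` sending the `i`-th
generator to `fᵢ`. -/
noncomputable def fCanon : FreeLieAlgebra ℝ I →ₗ⁅ℝ⁆ gZero I A :=
  FreeLieAlgebra.lift ℝ (Fgen I A)

namespace FreeLieAlgebra

variable {I}

theorem eq_top_of_forall_of_mem {R X : Type*} [CommRing R] (K : LieSubalgebra R (FreeLieAlgebra R X))
    (hK : ∀ x, of R x ∈ K) : K = ⊤ := by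
  have h : K.incl.comp (lift R fun x => (⟨of R x, hK x⟩ : K)) = LieHom.id := by
    ext x
    simp
  refine eq_top_iff.2 fun a _ => ?_
  have ha := LieHom.congr_fun h a
  rw [LieHom.comp_apply, LieHom.id_apply] at ha
  exact ha ▸ SetLike.coe_mem _

@[elab_as_elim]
theorem induction_on {R X : Type*} [CommRing R] {p : FreeLieAlgebra R X → Prop}
    (a : FreeLieAlgebra R X) (of : ∀ x, p (of R x)) (zero : p 0)
    (add : ∀ a b, p a → p b → p (a + b)) (smul : ∀ (c : R) a, p a → p (c • a))
    (lie : ∀ a b, p a → p b → p ⁅a, b⁆) : p a := by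
  let K : LieSubalgebra R (FreeLieAlgebra R X) :=
    { carrier := {a | p a}
      add_mem' := fun {a b} => add a b
      zero_mem' := zero
      smul_mem' := smul
      lie_mem' := fun {a b} => lie a b }
  have h : a ∈ K := eq_top_of_forall_of_mem K of ▸ LieSubalgebra.mem_top a
  exact h

theorem range_lift {R X L : Type*} [CommRing R] [LieRing L] [LieAlgebra R L] (g : X → L) :
    (lift R g).range = LieSubalgebra.lieSpan R L (Set.range g) := by
  apply le_antisymm
  · rintro _ ⟨a, rfl⟩
    induction a using FreeLieAlgebra.induction_on with
    | of x => simpa using LieSubalgebra.subset_lieSpan (Set.mem_range_self x)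
    | zero => simp
    | add a b ha hb => simpa using add_mem ha hb
    | smul c a ha => simpa using Submodule.smul_mem _ c ha
    | lie a b ha hb => simpa using LieSubalgebra.lie_mem _ ha hb
  · rw [LieSubalgebra.lieSpan_le]
    rintro _ ⟨x, rfl⟩
    exact ⟨of R x, by simp⟩

theorem linearIndependent_of {R X : Type*} [CommRing R] : LinearIndependent R (of R (X := X)) := by
  let _ : LieRing (X →₀ R) :=
    { bracket := fun _ _ => 0
      add_lie := by intros; exact (add_zero 0).symm
      lie_add := by intros; exact (add_zero 0).symm
      lie_self := fun _ => rfl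
      leibniz_lie := by intros; exact (add_zero 0).symm }
  let _ : LieAlgebra R (X →₀ R) := { lie_smul := fun c _ _ => (smul_zero c).symm }
  refine LinearIndependent.of_comp
    (lift R (L := X →₀ R) fun x => Finsupp.single x 1 : FreeLieAlgebra R X →ₗ[R] X →₀ R) ?_
  have h : lift R (L := X →₀ R) (fun x => Finsupp.single x 1) ∘ of R = fun x => Finsupp.single x 1 :=
    of_comp_lift ..
  have hli : LinearIndependent R fun x : X => Finsupp.single x (1 : R) := by
    simpa using (Finsupp.basisSingleOne (R := R) (ι := X)).linearIndependent
  exact h.symm ▸ hli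

attribute [local instance] LieRing.ofAssociativeRing

/-- Left multiplication by the letter `x` in the semidirect extension of the free Lie algebra `L`
by the grading derivation: `(l, c) ↦ (⁅x, l⁆ + c • x, 0)` on `L × R`. -/
noncomputable def letterEnd (R : Type*) {X : Type*} [CommRing R] (x : X) :
    Module.End R (FreeLieAlgebra R X × R) :=
  LinearMap.inl R _ R ∘ₗ
    ((LieAlgebra.ad R (FreeLieAlgebra R X) (of R x)).coprod (LinearMap.toSpanSingleton R _ (of R x)))

theorem letterEnd_apply {R X : Type*} [CommRing R] (x : X) (v : FreeLieAlgebra R X × R) :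
    letterEnd R x v = (⁅of R x, v.1⁆ + v.2 • of R x, 0) := rfl

/-- The grading operator of the free Lie algebra, which multiplies brackets of `n` letters
by `n`. -/
noncomputable def grading (R X : Type*) [CommRing R] : Module.End R (FreeLieAlgebra R X) :=
  LinearMap.fst R _ R ∘ₗ LinearMap.applyₗ (0, 1) ∘ₗ
    (lift R (letterEnd R (X := X)) :
      FreeLieAlgebra R X →ₗ[R] Module.End R (FreeLieAlgebra R X × R))

theorem grading_apply {R X : Type*} [CommRing R] (a : FreeLieAlgebra R X) :
    grading R X a = (lift R (letterEnd R (X := X)) a (0, 1)).1 := rfl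

theorem lift_letterEnd_apply {R X : Type*} [CommRing R] (a : FreeLieAlgebra R X)
    (v : FreeLieAlgebra R X × R) :
    lift R (letterEnd R (X := X)) a v = (⁅a, v.1⁆ + v.2 • grading R X a, 0) := by
  suffices h : ∃ d, ∀ v, lift R (letterEnd R (X := X)) a v = (⁅a, v.1⁆ + v.2 • d, 0) by
    obtain ⟨d, hd⟩ := h
    simp [grading_apply, hd]
  induction a using FreeLieAlgebra.induction_on with
  | of x => exact ⟨of R x, fun v => by simp [letterEnd_apply]⟩
  | zero => exact ⟨0, fun v => by simp; rfl⟩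
  | add a b ha hb =>
    obtain ⟨d, hd⟩ := ha
    obtain ⟨e, he⟩ := hb
    exact ⟨d + e, fun v => by simp [hd, he]; abel⟩
  | smul c a ha =>
    obtain ⟨d, hd⟩ := ha
    exact ⟨c • d, fun v => by simp [hd, smul_comm c]⟩
  | lie a b ha hb =>
    obtain ⟨d, hd⟩ := ha
    obtain ⟨e, he⟩ := hb
    refine ⟨⁅a, e⁆ - ⁅b, d⁆, fun v => ?_⟩
    simp [hd, he, LieHom.map_lie, LieRing.of_associative_ring_bracket, smul_sub]
    abel

theorem grading_of {R X : Type*} [CommRing R] (x : X) : grading R X (of R x) = of R x := by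
  simp [grading_apply, letterEnd_apply]

theorem grading_lie {R X : Type*} [CommRing R] (a b : FreeLieAlgebra R X) :
    grading R X ⁅a, b⁆ = ⁅grading R X a, b⁆ + ⁅a, grading R X b⁆ := by
  rw [grading_apply, LieHom.map_lie, LieRing.of_associative_ring_bracket]
  simp [lift_letterEnd_apply]
  rw [← lie_skew b, sub_neg_eq_add, add_comm]

theorem grading_injective (K X : Type*) [Field K] [CharZero K] :
    Function.Injective (grading K X) := by
  set p : Submodule K (FreeLieAlgebra K X) :=
    Submodule.span K {a | ∃ n : ℕ, grading K X a = ((n + 1 : ℕ) : K) • a} with hp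
  have hlie : ∀ a ∈ p, ∀ b ∈ p, ⁅a, b⁆ ∈ p := by
    intro a ha b hb
    induction ha, hb using Submodule.span_induction₂ with
    | mem_mem a b ha hb =>
      obtain ⟨m, hm⟩ := ha
      obtain ⟨n, hn⟩ := hb
      refine Submodule.subset_span ⟨m + n + 1, ?_⟩
      rw [grading_lie, hm, hn, smul_lie, lie_smul, ← add_smul]
      push_cast
      ring_nf
    | zero_left => simp
    | zero_right => simp
    | add_left _ _ _ _ _ _ h₁ h₂ => simpa using add_mem h₁ h₂
    | add_right _ _ _ _ _ _ h₁ h₂ => simpa using add_mem h₁ h₂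
    | smul_left c _ _ _ _ h => simpa using p.smul_mem c h
    | smul_right c _ _ _ _ h => simpa using p.smul_mem c h
  have htop : p = ⊤ := by
    refine eq_top_iff.2 fun a _ => ?_
    induction a using FreeLieAlgebra.induction_on with
    | of x => exact Submodule.subset_span ⟨0, by simp [grading_of]⟩
    | zero => exact zero_mem _
    | add a b ha hb => exact add_mem (ha trivial) (hb trivial)
    | smul c a ha => exact p.smul_mem c (ha trivial)
    | lie a b ha hb => exact hlie a (ha trivial) b (hb trivial)
  have hle : p ≤ ⨆ (c : K) (_ : c ≠ 0), (grading K X).eigenspace c := by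
    refine Submodule.span_le.2 ?_
    rintro a ⟨n, hn⟩
    exact Submodule.mem_iSup_of_mem _ (Submodule.mem_iSup_of_mem (Nat.cast_ne_zero.2 n.succ_ne_zero)
      (Module.End.mem_eigenspace_iff.2 hn))
  have hdisj := Module.End.eigenspaces_iSupIndep (grading K X) 0
  rw [show (⨆ (c : K) (_ : c ≠ 0), (grading K X).eigenspace c) = ⊤ from
    top_le_iff.1 (htop ▸ hle), disjoint_top, Module.End.eigenspace_zero] at hdisj
  exact LinearMap.ker_eq_bot.1 hdisj

/-- Left multiplication by the letter `x` on linear combinations of words. -/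
noncomputable def consEnd (R : Type*) {X : Type*} [CommRing R] (x : X) :
    Module.End R (List X →₀ R) :=
  Finsupp.lmapDomain R R (List.cons x)

@[simp]
theorem consEnd_single {R X : Type*} [CommRing R] (x : X) (w : List X) (c : R) :
    consEnd R x (Finsupp.single w c) = Finsupp.single (x :: w) c := by
  simp [consEnd]

theorem lift_consEnd_apply_nil {R X : Type*} [CommRing R] (a : FreeLieAlgebra R X)
    (v : List X →₀ R) : lift R (consEnd R (X := X)) a v [] = 0 := by
  induction a using FreeLieAlgebra.induction_on generalizing v with
  | of x =>
    rw [lift_of_apply]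
    exact Finsupp.mapDomain_of_notMem_range _ _ (by simp)
  | zero => simp
  | add a b ha hb => simp [ha, hb]
  | smul c a ha => simp [ha]
  | lie a b ha hb => simp [LieRing.of_associative_ring_bracket, ha, hb]

theorem eq_zero_of_lift_consEnd_single_nil {K X : Type*} [Field K] [CharZero K]
    {a : FreeLieAlgebra K X}
    (ha : lift K (consEnd K (X := X)) a (Finsupp.single [] 1) = 0) : a = 0 := by
  let δ : (List X →₀ K) →ₗ[K] FreeLieAlgebra K X × K :=
    Finsupp.linearCombination K fun w => w.foldr (fun x v => letterEnd K x v) (0, 1)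
  have h : ∀ v, δ (lift K (consEnd K (X := X)) a v) = lift K (letterEnd K (X := X)) a (δ v) := by
    clear ha
    induction a using FreeLieAlgebra.induction_on with
    | of x =>
      intro v
      simp only [lift_of_apply]
      induction v using Finsupp.induction_linear with
      | zero => simp
      | add v w hv hw => simp [hv, hw]
      | single w c => simp [δ]
    | zero => simp
    | add a b ha hb => simp [ha, hb]
    | smul c a ha => simp [ha]
    | lie a b ha hb => simp [LieRing.of_associative_ring_bracket, ha, hb]
  have h₁ := h (Finsupp.single [] 1)
  rw [ha, map_zero] at h₁
  refine grading_injective K X ?_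
  simpa [δ, lift_letterEnd_apply, eq_comm] using congrArg Prod.fst h₁

end FreeLieAlgebra

section

attribute [local instance] LieRing.ofAssociativeRing

/-- The quotient map onto `g₀(A)`, as a homomorphism of Lie algebras. -/
noncomputable def gZeroMk : FreeLieAlgebra ℝ (GKMGen I) →ₗ⁅ℝ⁆ gZero I A where
  toFun x := LieSubmodule.Quotient.mk' (LieSubmodule.lieSpan ℝ _ (gkmRels I A)) x
  map_add' _ _ := rfl
  map_smul' _ _ := rfl
  map_lie' := rfl

theorem gZeroMk_surjective : Function.Surjective (gZeroMk I A) :=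
  LieSubmodule.Quotient.surjective_mk' _

theorem gZeroMk_eq_zero_iff {x : FreeLieAlgebra ℝ (GKMGen I)} :
    gZeroMk I A x = 0 ↔ x ∈ LieSubmodule.lieSpan ℝ (FreeLieAlgebra ℝ (GKMGen I)) (gkmRels I A) :=
  LieSubmodule.Quotient.mk_eq_zero (N := LieSubmodule.lieSpan ℝ _ (gkmRels I A))

theorem gZeroMk_eq_zero {x : FreeLieAlgebra ℝ (GKMGen I)} (hx : x ∈ gkmRels I A) :
    gZeroMk I A x = 0 :=
  (gZeroMk_eq_zero_iff I A).2 (LieSubmodule.subset_lieSpan hx)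

theorem lie_Hgen_Hgen (i j : I) : ⁅Hgen I A i, Hgen I A j⁆ = 0 := by
  have h := gZeroMk_eq_zero I A (Or.inl (Or.inl (Or.inl ⟨i, j, rfl⟩)))
  rwa [LieHom.map_lie] at h

theorem lie_Hgen_Egen (i k : I) : ⁅Hgen I A i, Egen I A k⁆ = A i k • Egen I A k := by
  have h := gZeroMk_eq_zero I A (Or.inl (Or.inl (Or.inr ⟨i, k, rfl⟩)))
  rwa [map_sub, LieHom.map_lie, map_smul, sub_eq_zero] at h

theorem lie_Hgen_Fgen (i k : I) : ⁅Hgen I A i, Fgen I A k⁆ = -(A i k • Fgen I A k) := by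
  have h := gZeroMk_eq_zero I A (Or.inl (Or.inr ⟨i, k, rfl⟩))
  rwa [map_add, LieHom.map_lie, map_smul, add_eq_zero_iff_eq_neg] at h

theorem lie_Egen_Fgen (i j : I) :
    ⁅Egen I A i, Fgen I A j⁆ = if i = j then Hgen I A i else 0 := by
  have h := gZeroMk_eq_zero I A (Or.inr ⟨i, j, rfl⟩)
  rwa [map_sub, LieHom.map_lie, sub_eq_zero, apply_ite (gZeroMk I A), map_zero] at h

theorem LieHom.exists_factor {R L G M : Type*} [CommRing R] [LieRing L] [LieAlgebra R L]
    [LieRing G] [LieAlgebra R G] [LieRing M] [LieAlgebra R M] (q : L →ₗ⁅R⁆ G)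
    (hq : Function.Surjective q) (g : L →ₗ⁅R⁆ M) (hg : ∀ x, q x = 0 → g x = 0) :
    ∃ φ : G →ₗ⁅R⁆ M, ∀ x, φ (q x) = g x := by
  have hφ : ∀ x, g (Function.surjInv hq (q x)) = g x := fun x => by
    rw [← sub_eq_zero, ← map_sub]
    exact hg _ (by rw [map_sub, Function.surjInv_eq hq, sub_self])
  refine ⟨{ toFun := fun y => g (Function.surjInv hq y)
            map_add' := fun y z => ?_
            map_smul' := fun c y => ?_
            map_lie' := fun {y z} => ?_ }, hφ⟩
  · obtain ⟨a, rfl⟩ := hq y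
    obtain ⟨b, rfl⟩ := hq z
    rw [← map_add, hφ, hφ, hφ, map_add]
  · obtain ⟨a, rfl⟩ := hq y
    rw [← map_smul, hφ, hφ, map_smul, RingHom.id_apply]
  · obtain ⟨a, rfl⟩ := hq y
    obtain ⟨b, rfl⟩ := hq z
    simp only [← LieHom.map_lie, hφ]

/-- The universal property of `g₀(A)`. -/
theorem exists_gZero_lieHom {L : Type*} [LieRing L] [LieAlgebra ℝ L] (h e f : I → L)
    (hhh : ∀ i j, ⁅h i, h j⁆ = 0) (hhe : ∀ i k, ⁅h i, e k⁆ = A i k • e k)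
    (hhf : ∀ i k, ⁅h i, f k⁆ = -(A i k • f k))
    (hef : ∀ i j, ⁅e i, f j⁆ = if i = j then h i else 0) :
    ∃ φ : gZero I A →ₗ⁅ℝ⁆ L, (∀ i, φ (Hgen I A i) = h i) ∧ (∀ i, φ (Egen I A i) = e i) ∧
      ∀ i, φ (Fgen I A i) = f i := by
  let g : FreeLieAlgebra ℝ (GKMGen I) →ₗ⁅ℝ⁆ L := lift ℝ (GKMGen.rec h e f)
  have hg : LieSubmodule.lieSpan ℝ (FreeLieAlgebra ℝ (GKMGen I)) (gkmRels I A) ≤ g.ker := by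
    rw [LieSubmodule.lieSpan_le]
    rintro _ (((⟨i, j, rfl⟩ | ⟨i, j, rfl⟩) | ⟨i, j, rfl⟩) | ⟨i, j, rfl⟩)
    · simp [g, hhh]
    · simp [g, hhe]
    · simp [g, hhf]
    · simp only [SetLike.mem_coe, LieHom.mem_ker, g, map_sub, LieHom.map_lie, lift_of_apply, hef]
      split_ifs <;> simp
  obtain ⟨φ, hφ⟩ := LieHom.exists_factor (gZeroMk I A) (gZeroMk_surjective I A) g
    fun x hx => LieHom.mem_ker.1 (hg ((gZeroMk_eq_zero_iff I A).1 hx))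
  exact ⟨φ, fun i => (hφ _).trans (lift_of_apply ..), fun i => (hφ _).trans (lift_of_apply ..),
    fun i => (hφ _).trans (lift_of_apply ..)⟩

/-- A Lie algebra map `g₀(A) → g₀(A)` exchanging the `eᵢ` and the `fᵢ`. -/
theorem exists_chevalley :
    ∃ ω : gZero I A →ₗ⁅ℝ⁆ gZero I A, (∀ i, ω (Hgen I A i) = -Hgen I A i) ∧
      (∀ i, ω (Egen I A i) = Fgen I A i) ∧ ∀ i, ω (Fgen I A i) = Egen I A i := by
  refine exists_gZero_lieHom I A (fun i => -Hgen I A i) (Fgen I A) (Egen I A) ?_ ?_ ?_ ?_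
  · simp [lie_Hgen_Hgen]
  · simp [lie_Hgen_Fgen]
  · simp [lie_Hgen_Egen]
  · intro i j
    rw [← lie_skew, lie_Egen_Fgen]
    by_cases h : i = j
    · simp [h]
    · simp [h, Ne.symm h]

/-- The weight of a word `f_{j₁} ⋯ f_{jₛ}` under `hᵢ`, when the empty word has weight `lam`. -/
def wordWeight {I : Type} (A : I → I → ℝ) (lam : I → ℝ) (i : I) (w : List I) : ℝ :=
  lam i - (w.map (A i)).sum

/-- The diagonal action of `hᵢ` on words. -/
noncomputable def wordH {I : Type} (A : I → I → ℝ) (lam : I → ℝ) (i : I) :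
    Module.End ℝ (List I →₀ ℝ) :=
  Finsupp.linearCombination ℝ fun w => Finsupp.single w (wordWeight A lam i w)

/-- The value of `eᵢ` on a word. -/
noncomputable def wordEAux {I : Type} (A : I → I → ℝ) (lam : I → ℝ) (i : I) :
    List I → (List I →₀ ℝ)
  | [] => 0
  | j :: w => consEnd ℝ j (wordEAux A lam i w) +
      if i = j then Finsupp.single w (wordWeight A lam i w) else 0

/-- The action of `eᵢ` on words. -/
noncomputable def wordE {I : Type} (A : I → I → ℝ) (lam : I → ℝ) (i : I) :
    Module.End ℝ (List I →₀ ℝ) :=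
  Finsupp.linearCombination ℝ (wordEAux A lam i)

section

variable {I A} (lam : I → ℝ)

theorem wordH_single (i : I) (w : List I) (c : ℝ) :
    wordH A lam i (Finsupp.single w c) = wordWeight A lam i w • Finsupp.single w c := by
  simp [wordH, mul_comm]

theorem wordE_single (i : I) (w : List I) (c : ℝ) :
    wordE A lam i (Finsupp.single w c) = c • wordEAux A lam i w := by
  simp [wordE]

theorem wordWeight_cons (i j : I) (w : List I) :
    wordWeight A lam i (j :: w) = wordWeight A lam i w - A i j := by
  simp [wordWeight]; ring

theorem wordH_consEnd (i j : I) (v : List I →₀ ℝ) :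
    wordH A lam i (consEnd ℝ j v) = consEnd ℝ j (wordH A lam i v) - A i j • consEnd ℝ j v := by
  induction v using Finsupp.induction_linear with
  | zero => simp
  | add v w hv hw => simp only [map_add, hv, hw, smul_add]; abel
  | single w c => rw [consEnd_single, wordH_single, wordH_single, map_smul, consEnd_single, wordWeight_cons,
      sub_smul]

theorem wordE_consEnd (i j : I) (v : List I →₀ ℝ) :
    wordE A lam i (consEnd ℝ j v) =
      consEnd ℝ j (wordE A lam i v) + if i = j then wordH A lam i v else 0 := by
  induction v using Finsupp.induction_linear with
  | zero => simp
  | add v w hv hw => simp only [map_add, hv, hw]; split_ifs <;> abel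
  | single w c =>
    rw [consEnd_single, wordE_single, wordE_single, wordEAux, wordH_single]
    split_ifs <;> simp [mul_comm]

theorem wordH_wordEAux (i k : I) (w : List I) :
    wordH A lam i (wordEAux A lam k w) =
      (wordWeight A lam i w + A i k) • wordEAux A lam k w := by
  induction w with
  | nil => simp [wordEAux]
  | cons j w ih =>
    rw [wordEAux, map_add, wordH_consEnd, ih, wordWeight_cons]
    split_ifs with h
    · subst h
      rw [wordH_single, map_smul]
      module
    · rw [map_zero, map_smul]
      module

variable (I A) in
/-- The Verma-type module of `g₀(A)` on words in the `fᵢ` with highest weight `lam`. -/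
theorem exists_word_rep :
    ∃ ρ : gZero I A →ₗ⁅ℝ⁆ Module.End ℝ (List I →₀ ℝ), (∀ i, ρ (Hgen I A i) = wordH A lam i) ∧
      (∀ i, ρ (Egen I A i) = wordE A lam i) ∧ ∀ i, ρ (Fgen I A i) = consEnd ℝ i := by
  refine exists_gZero_lieHom I A _ _ _ ?_ ?_ ?_ ?_ <;> intro i j <;>
    rw [LieRing.of_associative_ring_bracket]
  · ext w : 2
    simp [wordH_single, mul_comm]
  · ext w : 2
    simp [wordH_single, wordE_single, wordH_wordEAux, add_smul, add_comm]
  · refine LinearMap.ext fun v => ?_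
    simp [wordH_consEnd]
  · refine LinearMap.ext fun v => ?_
    rw [LinearMap.sub_apply, Module.End.mul_apply, Module.End.mul_apply, wordE_consEnd]
    split_ifs <;> simp

end

theorem eCanon_range : (eCanon I A).range = nPlus I A := range_lift _

theorem fCanon_range : (fCanon I A).range = nMinus I A := range_lift _

variable {I A} in
theorem word_rep_fCanon {ρ : gZero I A →ₗ⁅ℝ⁆ Module.End ℝ (List I →₀ ℝ)}
    (hρ : ∀ i, ρ (Fgen I A i) = consEnd ℝ i) (a : FreeLieAlgebra ℝ I) :
    ρ (fCanon I A a) = lift ℝ (consEnd ℝ) a := by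
  have : ρ.comp (fCanon I A) = lift ℝ (consEnd ℝ) := by
    ext i : 1
    simp [fCanon, hρ]
  exact LieHom.congr_fun this a

theorem fCanon_injective : Function.Injective (fCanon I A) := by
  obtain ⟨ρ, -, -, hρ⟩ := exists_word_rep I A 0
  refine (injective_iff_map_eq_zero _).2 fun a ha => eq_zero_of_lift_consEnd_single_nil ?_
  rw [← word_rep_fCanon hρ, ha, map_zero, LinearMap.zero_apply]

theorem eCanon_injective : Function.Injective (eCanon I A) := by
  obtain ⟨ω, -, hω, -⟩ := exists_chevalley I A
  have : ω.comp (eCanon I A) = fCanon I A := by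
    ext i : 1
    simp [eCanon, fCanon, hω]
  refine Function.Injective.of_comp (f := ω) ?_
  rw [← LieHom.coe_comp, this]
  exact fCanon_injective I A

theorem word_rep_eCanon_single_nil {I : Type} {A : I → I → ℝ} {lam : I → ℝ}
    {ρ : gZero I A →ₗ⁅ℝ⁆ Module.End ℝ (List I →₀ ℝ)}
    (hρ : ∀ i, ρ (Egen I A i) = wordE A lam i) (a : FreeLieAlgebra ℝ I) :
    ρ (eCanon I A a) (Finsupp.single [] 1) = 0 := by
  induction a using FreeLieAlgebra.induction_on with
  | of x => simp [eCanon, hρ, wordE_single, wordEAux]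
  | zero => simp
  | add a b ha hb => simp [ha, hb]
  | smul c a ha => simp [ha]
  | lie a b ha hb => simp [LieRing.of_associative_ring_bracket, ha, hb]

theorem fCanon_add_Hgen_add_eCanon_eq_zero {a b : FreeLieAlgebra ℝ I} {c : I →₀ ℝ}
    (h : fCanon I A a + Finsupp.linearCombination ℝ (Hgen I A) c + eCanon I A b = 0) :
    a = 0 ∧ c = 0 ∧ b = 0 := by
  have key : ∀ lam : I → ℝ, lift ℝ (consEnd ℝ) a (Finsupp.single [] 1) +
      Finsupp.single [] (Finsupp.linearCombination ℝ lam c) = 0 := by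
    intro lam
    obtain ⟨ρ, hH, hE, hF⟩ := exists_word_rep I A lam
    have h₁ : ρ (Finsupp.linearCombination ℝ (Hgen I A) c) (Finsupp.single [] 1) =
        Finsupp.single [] (Finsupp.linearCombination ℝ lam c) := by
      simp only [Finsupp.linearCombination_apply, Finsupp.sum, map_sum, map_smul, hH,
        LinearMap.sum_apply, LinearMap.smul_apply, wordH_single, Finsupp.single_finsetSum]
      simp [wordWeight]
    have h₂ := congrArg (fun x => ρ x (Finsupp.single [] 1)) h
    simpa only [map_add, LinearMap.add_apply, word_rep_fCanon hF, h₁,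
      word_rep_eCanon_single_nil hE, add_zero, map_zero, LinearMap.zero_apply] using h₂
  have hc : c = 0 := by
    ext i
    have h₁ := DFunLike.congr_fun (key (Pi.single i 1)) []
    simpa [lift_consEnd_apply_nil, Finsupp.linearCombination_apply, Finsupp.sum, Pi.single_apply]
      using h₁
  subst hc
  have ha : a = 0 := eq_zero_of_lift_consEnd_single_nil (by simpa using key 0)
  subst ha
  exact ⟨rfl, rfl, eCanon_injective I A (by simpa using h)⟩

end

theorem linearIndependent_Hgen : LinearIndependent ℝ (Hgen I A) :=
  linearIndependent_iff.2 fun c hc =>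
    (fCanon_add_Hgen_add_eCanon_eq_zero I A (a := 0) (b := 0) (by simp [hc])).2.1

theorem triangular_eq_zero {m h p : gZero I A} (hm : m ∈ nMinus I A) (hh : h ∈ hPart I A)
    (hp : p ∈ nPlus I A) (hmhp : m + h + p = 0) : m = 0 ∧ h = 0 ∧ p = 0 := by
  rw [← fCanon_range] at hm
  rw [← eCanon_range] at hp
  obtain ⟨a, rfl⟩ := hm
  obtain ⟨b, rfl⟩ := hp
  obtain ⟨c, rfl⟩ := Finsupp.mem_span_range_iff_exists_finsupp.1 hh
  obtain ⟨rfl, rfl, rfl⟩ := fCanon_add_Hgen_add_eCanon_eq_zero I A hmhp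
  simp

theorem LieSubalgebra.lie_mem_lieSpan {R L : Type*} [CommRing R] [LieRing L] [LieAlgebra R L]
    {s : Set L} {z : L} (hz : ∀ x ∈ s, ⁅z, x⁆ ∈ lieSpan R L s) {x : L} (hx : x ∈ lieSpan R L s) :
    ⁅z, x⁆ ∈ lieSpan R L s := by
  induction hx using LieSubalgebra.lieSpan_induction with
  | mem x hx => exact hz x hx
  | zero => simp
  | add x y _ _ hx hy => simpa using add_mem hx hy
  | smul c x _ hx => simpa using Submodule.smul_mem _ c hx
  | lie x y hx' hy' hx hy =>
    rw [leibniz_lie]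
    exact add_mem (LieSubalgebra.lie_mem _ hx hy') (LieSubalgebra.lie_mem _ hx' hy)

theorem LieSubalgebra.lie_mem_sup_lieSpan {R L : Type*} [CommRing R] [LieRing L] [LieAlgebra R L]
    {s : Set L} {z : L} {H : Submodule R L} (hH : ∀ h ∈ H, ∀ x ∈ s, ⁅h, x⁆ ∈ lieSpan R L s)
    (hz : ∀ x ∈ s, ⁅z, x⁆ ∈ H) {x : L} (hx : x ∈ lieSpan R L s) :
    ⁅z, x⁆ ∈ H ⊔ (lieSpan R L s).toSubmodule := by
  have aux : ∀ w ∈ H ⊔ (lieSpan R L s).toSubmodule, ∀ y ∈ lieSpan R L s,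
      ⁅w, y⁆ ∈ H ⊔ (lieSpan R L s).toSubmodule := by
    intro w hw y hy
    obtain ⟨h, hh, n, hn, rfl⟩ := Submodule.mem_sup.1 hw
    rw [add_lie]
    exact Submodule.mem_sup_right
      (add_mem (lie_mem_lieSpan (hH h hh) hy) (LieSubalgebra.lie_mem _ hn hy))
  induction hx using LieSubalgebra.lieSpan_induction with
  | mem x hx => exact Submodule.mem_sup_left (hz x hx)
  | zero => simp
  | add x y _ _ hx hy => simpa using add_mem hx hy
  | smul c x _ hx => simpa using Submodule.smul_mem _ c hx
  | lie x y hx' hy' hx hy =>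
    rw [leibniz_lie, ← lie_skew x]
    exact add_mem (aux _ hx _ hy') (neg_mem (aux _ hy _ hx'))

theorem lie_hPart_hPart {x y : gZero I A} (hx : x ∈ hPart I A) (hy : y ∈ hPart I A) :
    ⁅x, y⁆ = 0 := by
  induction hx, hy using Submodule.span_induction₂ with
  | mem_mem x y hx hy =>
    obtain ⟨i, rfl⟩ := hx
    obtain ⟨j, rfl⟩ := hy
    exact lie_Hgen_Hgen I A i j
  | zero_left => simp
  | zero_right => simp
  | add_left _ _ _ _ _ _ h₁ h₂ => simp [h₁, h₂]
  | add_right _ _ _ _ _ _ h₁ h₂ => simp [h₁, h₂]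
  | smul_left c _ _ _ _ h => simp [h]
  | smul_right c _ _ _ _ h => simp [h]

theorem Egen_mem_nPlus (i : I) : Egen I A i ∈ nPlus I A :=
  LieSubalgebra.subset_lieSpan ⟨i, rfl⟩

theorem Fgen_mem_nMinus (i : I) : Fgen I A i ∈ nMinus I A :=
  LieSubalgebra.subset_lieSpan ⟨i, rfl⟩

theorem Hgen_mem_hPart (i : I) : Hgen I A i ∈ hPart I A :=
  Submodule.subset_span ⟨i, rfl⟩

theorem lie_hPart_Egen {h : gZero I A} (hh : h ∈ hPart I A) (k : I) :
    ⁅h, Egen I A k⁆ ∈ nPlus I A := by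
  induction hh using Submodule.span_induction with
  | mem x hx =>
    obtain ⟨i, rfl⟩ := hx
    rw [lie_Hgen_Egen]
    exact Submodule.smul_mem _ _ (Egen_mem_nPlus I A k)
  | zero => simp
  | add x y _ _ hx hy => simpa using add_mem hx hy
  | smul c x _ hx => simpa using Submodule.smul_mem _ c hx

theorem lie_hPart_Fgen {h : gZero I A} (hh : h ∈ hPart I A) (k : I) :
    ⁅h, Fgen I A k⁆ ∈ nMinus I A := by
  induction hh using Submodule.span_induction with
  | mem x hx =>
    obtain ⟨i, rfl⟩ := hx
    rw [lie_Hgen_Fgen]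
    exact neg_mem (Submodule.smul_mem _ _ (Fgen_mem_nMinus I A k))
  | zero => simp
  | add x y _ _ hx hy => simpa using add_mem hx hy
  | smul c x _ hx => simpa using Submodule.smul_mem _ c hx

theorem lie_Egen_Fgen_mem (i j : I) : ⁅Egen I A i, Fgen I A j⁆ ∈ hPart I A := by
  rw [lie_Egen_Fgen]
  split_ifs
  · exact Hgen_mem_hPart I A i
  · exact zero_mem _

theorem lie_Egen_mem {x : gZero I A} (hx : x ∈ nMinus I A) (i : I) :
    ⁅Egen I A i, x⁆ ∈ hPart I A ⊔ (nMinus I A).toSubmodule := by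
  refine LieSubalgebra.lie_mem_sup_lieSpan ?_ ?_ hx
  · rintro h hh _ ⟨k, rfl⟩
    exact lie_hPart_Fgen I A hh k
  · rintro _ ⟨j, rfl⟩
    exact lie_Egen_Fgen_mem I A i j

theorem lie_Fgen_mem {x : gZero I A} (hx : x ∈ nPlus I A) (j : I) :
    ⁅Fgen I A j, x⁆ ∈ hPart I A ⊔ (nPlus I A).toSubmodule := by
  refine LieSubalgebra.lie_mem_sup_lieSpan ?_ ?_ hx
  · rintro h hh _ ⟨k, rfl⟩
    exact lie_hPart_Egen I A hh k
  · rintro _ ⟨i, rfl⟩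
    rw [← lie_skew]
    exact neg_mem (lie_Egen_Fgen_mem I A i j)

theorem triangular_sup_eq_top :
    (nMinus I A).toSubmodule ⊔ hPart I A ⊔ (nPlus I A).toSubmodule = ⊤ := by
  set S := (nMinus I A).toSubmodule ⊔ hPart I A ⊔ (nPlus I A).toSubmodule with hS
  have hm : (nMinus I A).toSubmodule ≤ S := le_sup_of_le_left le_sup_left
  have hh : hPart I A ≤ S := le_sup_of_le_left le_sup_right
  have hp : (nPlus I A).toSubmodule ≤ S := le_sup_right
  have hgen : ∀ x, gen I A x ∈ S ∧ ∀ y ∈ S, ⁅gen I A x, y⁆ ∈ S := by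
    rintro (i | i | i)
    · refine ⟨hh (Hgen_mem_hPart I A i), fun y hy => ?_⟩
      obtain ⟨_, hmh, p, hp', rfl⟩ := Submodule.mem_sup.1 hy
      obtain ⟨m, hm', h, hh', rfl⟩ := Submodule.mem_sup.1 hmh
      rw [lie_add, lie_add]
      refine add_mem (add_mem (hm ?_) (hh ?_)) (hp ?_)
      · refine LieSubalgebra.lie_mem_lieSpan ?_ hm'
        rintro _ ⟨k, rfl⟩
        exact lie_hPart_Fgen I A (Hgen_mem_hPart I A i) k
      · exact lie_hPart_hPart I A (Hgen_mem_hPart I A i) hh' ▸ zero_mem _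
      · refine LieSubalgebra.lie_mem_lieSpan ?_ hp'
        rintro _ ⟨k, rfl⟩
        exact lie_hPart_Egen I A (Hgen_mem_hPart I A i) k
    · refine ⟨hp (Egen_mem_nPlus I A i), fun y hy => ?_⟩
      obtain ⟨_, hmh, p, hp', rfl⟩ := Submodule.mem_sup.1 hy
      obtain ⟨m, hm', h, hh', rfl⟩ := Submodule.mem_sup.1 hmh
      rw [lie_add, lie_add]
      refine add_mem (add_mem (sup_le hh hm (lie_Egen_mem I A hm' i)) (hp ?_))
        (hp (LieSubalgebra.lie_mem _ (Egen_mem_nPlus I A i) hp'))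
      rw [← lie_skew]
      exact neg_mem (lie_hPart_Egen I A hh' i)
    · refine ⟨hm (Fgen_mem_nMinus I A i), fun y hy => ?_⟩
      obtain ⟨_, hmh, p, hp', rfl⟩ := Submodule.mem_sup.1 hy
      obtain ⟨m, hm', h, hh', rfl⟩ := Submodule.mem_sup.1 hmh
      rw [lie_add, lie_add]
      refine add_mem (add_mem (hm (LieSubalgebra.lie_mem _ (Fgen_mem_nMinus I A i) hm')) (hm ?_))
        (sup_le hh hp (lie_Fgen_mem I A hp' i))
      rw [← lie_skew]
      exact neg_mem (lie_hPart_Fgen I A hh' i)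
  have hfree : ∀ a, gZeroMk I A a ∈ S ∧ ∀ y ∈ S, ⁅gZeroMk I A a, y⁆ ∈ S := by
    intro a
    induction a using FreeLieAlgebra.induction_on with
    | of x => exact hgen x
    | zero => simp
    | add a b ha hb =>
      rw [map_add]
      refine ⟨add_mem ha.1 hb.1, fun y hy => ?_⟩
      rw [add_lie]
      exact add_mem (ha.2 y hy) (hb.2 y hy)
    | smul c a ha =>
      rw [map_smul]
      refine ⟨S.smul_mem c ha.1, fun y hy => ?_⟩
      rw [smul_lie]
      exact S.smul_mem c (ha.2 y hy)
    | lie a b ha hb =>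
      rw [LieHom.map_lie]
      refine ⟨ha.2 _ hb.1, fun y hy => ?_⟩
      rw [lie_lie]
      exact sub_mem (ha.2 _ (hb.2 y hy)) (hb.2 _ (ha.2 y hy))
  refine eq_top_iff.2 fun x _ => ?_
  obtain ⟨a, rfl⟩ := gZeroMk_surjective I A x
  exact (hfree a).1

theorem triangular_isInternal :
    DirectSum.IsInternal ![(nMinus I A).toSubmodule, hPart I A, (nPlus I A).toSubmodule] := by
  rw [DirectSum.isInternal_submodule_iff_iSupIndep_and_iSup_eq_top]
  constructor
  · rw [iSupIndep_iff_finsetSum_eq_zero_imp_eq_zero]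
    intro s v hv hsum
    have hmem : ∀ i, (if i ∈ s then v i else 0) ∈
        ![(nMinus I A).toSubmodule, hPart I A, (nPlus I A).toSubmodule] i := by
      intro i
      split_ifs with hi
      · exact hv i hi
      · exact zero_mem _
    have h : ∑ i, (if i ∈ s then v i else 0) = 0 := by
      rwa [Finset.sum_ite_mem, Finset.univ_inter]
    rw [Fin.sum_univ_three] at h
    obtain ⟨h₀, h₁, h₂⟩ := triangular_eq_zero I A (hmem 0) (hmem 1) (hmem 2) h
    intro i hi
    fin_cases i
    · exact (if_pos hi).symm.trans h₀
    · exact (if_pos hi).symm.trans h₁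
    · exact (if_pos hi).symm.trans h₂
  · rw [← triangular_sup_eq_top I A]
    apply le_antisymm
    · refine iSup_le fun i => ?_
      fin_cases i
      · exact le_sup_of_le_left le_sup_left
      · exact le_sup_of_le_left le_sup_right
      · exact le_sup_right
    · exact sup_le (sup_le (le_iSup_of_le 0 le_rfl) (le_iSup_of_le 1 le_rfl))
        (le_iSup_of_le 2 le_rfl)

theorem linearIndependent_of_injective_lift {R X L : Type*} [CommRing R] [LieRing L]
    [LieAlgebra R L] {g : X → L} (hg : Function.Injective (lift R g)) :
    LinearIndependent R g := by
  have h : LinearIndependent R (lift R g ∘ of R) :=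
    linearIndependent_of.map_injOn (lift R g : FreeLieAlgebra R X →ₗ[R] L) hg.injOn
  rwa [of_comp_lift] at h

theorem linearIndependent_Egen : LinearIndependent ℝ (Egen I A) :=
  linearIndependent_of_injective_lift (eCanon_injective I A)

theorem linearIndependent_Fgen : LinearIndependent ℝ (Fgen I A) :=
  linearIndependent_of_injective_lift (fCanon_injective I A)

theorem linearIndependent_gen : LinearIndependent ℝ (gen I A) := by
  have hE : Submodule.span ℝ (Set.range (Egen I A)) ≤ (nPlus I A).toSubmodule :=
    Submodule.span_le.2 LieSubalgebra.subset_lieSpan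
  have hF : Submodule.span ℝ (Set.range (Fgen I A)) ≤ (nMinus I A).toSubmodule :=
    Submodule.span_le.2 LieSubalgebra.subset_lieSpan
  have h₁ : LinearIndependent ℝ (Sum.elim (Hgen I A) (Egen I A)) := by
    refine (linearIndependent_Hgen I A).sum_type (linearIndependent_Egen I A) ?_
    refine Submodule.disjoint_def.2 fun x hx hx' => ?_
    exact (triangular_eq_zero I A (zero_mem _) hx (neg_mem (hE hx')) (by simp)).2.1
  have h₂ : LinearIndependent ℝ (Sum.elim (Fgen I A) (Sum.elim (Hgen I A) (Egen I A))) := by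
    refine (linearIndependent_Fgen I A).sum_type h₁ ?_
    refine Submodule.disjoint_def.2 fun x hx hx' => ?_
    rw [Set.Sum.elim_range, Submodule.span_union] at hx'
    obtain ⟨h, hh, p, hp, rfl⟩ := Submodule.mem_sup.1 hx'
    exact (triangular_eq_zero I A (hF hx) (neg_mem hh) (neg_mem (hE hp)) (by abel)).1
  let g : GKMGen I → I ⊕ (I ⊕ I)
    | .h i => .inr (.inl i)
    | .e i => .inr (.inr i)
    | .f i => .inl i
  have hg : Function.Injective g := by
    rintro (i | i | i) (j | j | j) h <;> simp_all [g]
  convert h₂.comp g hg using 1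
  ext x
  cases x <;> rfl

theorem gZero_triangular_decomposition (I : Type) [Countable I] (A : I → I → ℝ) :
    -- triangular decomposition as a direct sum of vector spaces
    DirectSum.IsInternal
      ![(nMinus I A).toSubmodule, hPart I A, (nPlus I A).toSubmodule] ∧
    -- `h` is an abelian subalgebra with the images of the `hᵢ` as a basis
    (∀ x ∈ hPart I A, ∀ y ∈ hPart I A, ⁅x, y⁆ = 0) ∧
    LinearIndependent ℝ (Hgen I A) ∧
    -- `n⁺` is the free Lie algebra on the `eᵢ`
    Function.Injective (eCanon I A) ∧ (eCanon I A).range = nPlus I A ∧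
    -- `n⁻` is the free Lie algebra on the `fᵢ`
    Function.Injective (fCanon I A) ∧ (fCanon I A).range = nMinus I A ∧
    -- the images of the `eᵢ, fᵢ, hᵢ` are linearly independent
    LinearIndependent ℝ (gen I A) := by
  exact ⟨triangular_isInternal I A, fun _ hx _ hy => lie_hPart_hPart I A hx hy,
    linearIndependent_Hgen I A, eCanon_injective I A, eCanon_range I A, fCanon_injective I A,
    fCanon_range I A, linearIndependent_gen I A⟩
end

section
/- Let I be an at most countable index set and A = (a_{ij})_{i,j∈I} a real matrix. In the Lie algebra ĝ_0(A), the element h_{ij} is zero unless the i-th and j-th columns of A are equal, i.e. h_{ij} = 0 unless a_{ki} = a_{kj} for all k ∈ I. -/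
/-!
Statement 2: in `ĝ₀(A)`, the element `h i j` vanishes unless the `i`-th and `j`-th
columns of `A` coincide.
-/

open FreeLieAlgebra
open scoped Classical

/-- The generators of `ĝ₀(A)`: `h i j`, `e i`, `f i` for `i, j ∈ I`. -/
inductive HatGen (I : Type) : Type
  | h (i j : I)
  | e (i : I)
  | f (i : I)

variable (I : Type) (A : I → I → ℝ)

/-- The defining relation elements (R1')-(R3') inside the free Lie algebra. -/
def hatRels : Set (FreeLieAlgebra ℝ (HatGen I)) :=
  {x | ∃ i j k l : I, x = ⁅of ℝ (HatGen.h i j), of ℝ (HatGen.h k l)⁆} ∪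
  {x | ∃ i j k : I, x = ⁅of ℝ (HatGen.h i j), of ℝ (HatGen.e k)⁆ -
      (if i = j then A i k else 0) • of ℝ (HatGen.e k)} ∪
  {x | ∃ i j k : I, x = ⁅of ℝ (HatGen.h i j), of ℝ (HatGen.f k)⁆ +
      (if i = j then A i k else 0) • of ℝ (HatGen.f k)} ∪
  {x | ∃ i j : I, x = ⁅of ℝ (HatGen.e i), of ℝ (HatGen.f j)⁆ - of ℝ (HatGen.h i j)}

/-- `ĝ₀(A)`, the quotient of the free Lie algebra by the ideal generated by (R1')-(R3'). -/
def hatGZero := FreeLieAlgebra ℝ (HatGen I) ⧸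
  LieSubmodule.lieSpan ℝ (FreeLieAlgebra ℝ (HatGen I)) (hatRels I A)

noncomputable instance : LieRing (hatGZero I A) := by unfold hatGZero; infer_instance
noncomputable instance : LieAlgebra ℝ (hatGZero I A) := by unfold hatGZero; infer_instance

/-- The image of a free generator in `ĝ₀(A)`. -/
noncomputable def hatGen (x : HatGen I) : hatGZero I A :=
  LieSubmodule.Quotient.mk' _ (of ℝ x)

noncomputable def hatE (i : I) : hatGZero I A := hatGen I A (HatGen.e i)
noncomputable def hatF (i : I) : hatGZero I A := hatGen I A (HatGen.f i)
noncomputable def hatH (i j : I) : hatGZero I A := hatGen I A (HatGen.h i j)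


/-- If `x` scales `y` by `a` and `z` by `-b` modulo a Lie ideal, and the ideal contains
`⁅x, w⁆` for `w` congruent to `⁅y, z⁆`, then it contains `w` as soon as `a ≠ b`. -/
theorem LieIdeal.mem_of_weight_ne {K L : Type*} [Field K] [LieRing L] [LieAlgebra K L]
    (N : LieIdeal K L) {x y z w : L} {a b : K} (hab : a ≠ b)
    (hy : ⁅x, y⁆ - a • y ∈ N) (hz : ⁅x, z⁆ + b • z ∈ N)
    (hw : ⁅y, z⁆ - w ∈ N) (hxw : ⁅x, w⁆ ∈ N) : w ∈ N := by
  have hyz : ⁅⁅x, y⁆ - a • y, z⁆ ∈ N := lie_mem_left K L N _ _ hy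
  have hzy : ⁅y, ⁅x, z⁆ + b • z⁆ ∈ N := lie_mem_right K L N _ _ hz
  have hxyz : ⁅x, ⁅y, z⁆ - w⁆ ∈ N := lie_mem_right K L N _ _ hw
  have key : (a - b) • w = ⁅x, ⁅y, z⁆ - w⁆ + ⁅x, w⁆ - ⁅⁅x, y⁆ - a • y, z⁆
      - ⁅y, ⁅x, z⁆ + b • z⁆ - (a - b) • (⁅y, z⁆ - w) := by
    rw [lie_sub, leibniz_lie x y z]
    simp only [sub_lie, lie_add, smul_lie, lie_smul]
    module
  have hmem : (a - b) • w ∈ N := by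
    rw [key]
    exact sub_mem (sub_mem (sub_mem (add_mem hxyz hxw) hyz) hzy) (N.smul_mem _ hw)
  simpa [smul_smul, inv_mul_cancel₀ (sub_ne_zero.2 hab)] using N.smul_mem (a - b)⁻¹ hmem

theorem hatH_eq_zero_of_columns_ne (I : Type) [Countable I] (A : I → I → ℝ)
    (i j : I) (h : ¬ ∀ k : I, A k i = A k j) :
    hatH I A i j = 0 := by
  obtain ⟨k, hk⟩ := not_forall.1 h
  have hrel : ∀ x ∈ hatRels I A, x ∈
      LieSubmodule.lieSpan ℝ (FreeLieAlgebra ℝ (HatGen I)) (hatRels I A) :=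
    fun _ hx => LieSubmodule.subset_lieSpan hx
  refine (LieSubmodule.Quotient.mk_eq_zero' (N := LieSubmodule.lieSpan ℝ
    (FreeLieAlgebra ℝ (HatGen I)) (hatRels I A))).2 ?_
  refine LieIdeal.mem_of_weight_ne _ (x := of ℝ (HatGen.h k k)) (y := of ℝ (HatGen.e i))
    (z := of ℝ (HatGen.f j)) hk ?_ ?_ ?_ ?_ <;> apply hrel
  · exact .inl (.inl (.inr ⟨k, k, i, by simp⟩))
  · exact .inl (.inr ⟨k, k, j, by simp⟩)
  · exact .inr ⟨i, j, rfl⟩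
  · exact .inl (.inl (.inl ⟨k, k, i, j, rfl⟩))
end

section
/- Let I be an at most countable index set and A = (a_{ij})_{i,j∈I} a real matrix satisfying (C1) A symmetric, (C2) a_{ij} ≤ 0 for i ≠ j, (C3) 2a_{ij}/a_{ii} ∈ ℤ for all j whenever a_{ii} > 0. Then in ĝ_0(A), for all i,j,k ∈ I with i ≠ j and a_{ii} > 0, one has [e_k, d^-_{ij}] = 0 and [f_k, d^+_{ij}] = 0, where d^+_{ij} = (ad e_i)^{1-2a_{ij}/a_{ii}} e_j and d^-_{ij} = (ad f_i)^{1-2a_{ij}/a_{ii}} f_j. -/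
/-!
Statement 4: in `ĝ₀(A)` (with `A` satisfying C1-C3), for `i ≠ j` with `aᵢᵢ > 0`,
`⁅e_k, d⁻ᵢⱼ⁆ = 0` and `⁅f_k, d⁺ᵢⱼ⁆ = 0`.
-/

open FreeLieAlgebra
open scoped Classical

variable (I : Type) (A : I → I → ℝ)

/-- In a Lie algebra whose elements `e i`, `f i` satisfy the Cartan-type relations, `e k` commutes
with the Serre element `(ad fᵢ)ⁿ fⱼ`, where `n = 1 - 2 aᵢⱼ / aᵢᵢ`. -/
theorem lie_ad_pow_eq_zero {ι L : Type*} [LieRing L] [LieAlgebra ℝ L] (A : ι → ι → ℝ) (e f : ι → L)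
    (hne : ∀ i j k, i ≠ j → ⁅⁅e i, f j⁆, f k⁆ = 0)
    (heq : ∀ i k, ⁅⁅e i, f i⁆, f k⁆ = -(A i k • f k))
    {i j : ι} (k : ι) (hij : i ≠ j) (hsymm : A i j = A j i) (hneg : A i j ≤ 0) (hii : 0 < A i i)
    (n : ℕ) (hn : (n : ℝ) = 1 - 2 * A i j / A i i) :
    ⁅e k, ((LieAlgebra.ad ℝ L (f i)) ^ n) (f j)⁆ = 0 := by
  have hn_mul : ((n : ℝ) - 1) * A i i = -(2 * A i j) := by
    rw [hn]; field_simp; ring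
  have hn_pos : n ≠ 0 := by
    rintro rfl
    norm_num at hn_mul
    linarith
  obtain ⟨m, rfl⟩ := Nat.exists_eq_succ_of_ne_zero hn_pos
  set x : ℕ → L := fun m => ((LieAlgebra.ad ℝ L (f i)) ^ m) (f j) with hx
  have x_zero : x 0 = f j := by simp [hx]
  have x_succ (m : ℕ) : x (m + 1) = ⁅f i, x m⁆ := by
    simp [hx, pow_succ', LieAlgebra.ad_apply]
  have e_x_succ (k : ι) (m : ℕ) : ⁅e k, x (m + 1)⁆ = ⁅⁅e k, f i⁆, x m⁆ + ⁅f i, ⁅e k, x m⁆⁆ := by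
    rw [x_succ, leibniz_lie]
  change ⁅e k, x (m + 1)⁆ = 0
  by_cases hki : k = i
  · subst hki
    have weight (m : ℕ) : ⁅⁅e k, f k⁆, x m⁆ = -((m * A k k + A k j) • x m) := by
      induction m with
      | zero => simp [x_zero, heq]
      | succ m ih =>
        rw [x_succ, leibniz_lie, heq, ih, neg_lie, lie_neg, smul_lie, lie_smul]
        push_cast
        module
    have lowering (m : ℕ) :
        ⁅e k, x (m + 1)⁆ = -(((m + 1) * (A k j + m / 2 * A k k)) • x m) := by
      induction m with
      | zero =>
        rw [e_x_succ, weight, x_zero, ← lie_skew (f k), hne _ _ _ hij]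
        simp
      | succ m ih =>
        rw [e_x_succ, weight, ih, lie_neg, lie_smul, ← x_succ]
        push_cast
        module
    have : A k j + m / 2 * A k k = 0 := by
      push_cast at hn_mul
      linarith
    rw [lowering, this]
    simp
  · have h_x (m : ℕ) : ⁅⁅e k, f i⁆, x m⁆ = 0 := by
      induction m with
      | zero => rw [x_zero, hne _ _ _ hki]
      | succ m ih => rw [x_succ, leibniz_lie, hne _ _ _ hki, ih]; simp
    have e_x_one : ⁅e k, x 1⁆ = ⁅f i, ⁅e k, f j⁆⁆ := by
      rw [e_x_succ, h_x, x_zero, zero_add]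
    by_cases hkj : k = j
    · subst hkj
      have e_x_one' : ⁅e k, x 1⁆ = A i k • f i := by
        rw [e_x_one, ← lie_skew, heq, neg_neg, hsymm]
      have hzero (m : ℕ) : ⁅e k, x (m + 2)⁆ = 0 := by
        induction m with
        | zero => rw [e_x_succ, h_x, zero_add, e_x_one', lie_smul, lie_self, smul_zero]
        | succ m ih => rw [e_x_succ, h_x, ih]; simp
      cases m with
      | zero =>
        have : A i k = 0 := by
          norm_num at hn_mul
          exact hn_mul
        rw [zero_add, e_x_one', this, zero_smul]
      | succ m => exact hzero m
    · have hzero (m : ℕ) : ⁅e k, x (m + 1)⁆ = 0 := by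
        induction m with
        | zero => rw [zero_add, e_x_one, ← lie_skew, hne _ _ _ hkj, neg_zero]
        | succ m ih => rw [e_x_succ, h_x, ih]; simp
      exact hzero m

/-- The projection of the free Lie algebra onto `ĝ₀(A)`. -/
noncomputable def hatProj (I : Type) (A : I → I → ℝ) :
    FreeLieAlgebra ℝ (HatGen I) →ₗ[ℝ] FreeLieAlgebra ℝ (HatGen I) ⧸
      LieSubmodule.lieSpan ℝ (FreeLieAlgebra ℝ (HatGen I)) (hatRels I A) :=
  (LieSubmodule.Quotient.mk' _).toLinearMap

theorem hatProj_eq_zero (I : Type) (A : I → I → ℝ) {x : FreeLieAlgebra ℝ (HatGen I)}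
    (hx : x ∈ hatRels I A) : hatProj I A x = 0 :=
  (LieSubmodule.Quotient.mk_eq_zero' (N := LieSubmodule.lieSpan ℝ _ (hatRels I A))).2
    (LieSubmodule.subset_lieSpan hx)

theorem hatE_lie_hatF (I : Type) (A : I → I → ℝ) (i j : I) :
    ⁅hatE I A i, hatF I A j⁆ = hatH I A i j := by
  have h := hatProj_eq_zero I A (Or.inr ⟨i, j, rfl⟩)
  rw [map_sub] at h
  exact sub_eq_zero.1 h

theorem hatH_lie_hatE (I : Type) (A : I → I → ℝ) (i j k : I) :
    ⁅hatH I A i j, hatE I A k⁆ = (if i = j then A i k else 0) • hatE I A k := by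
  have h := hatProj_eq_zero I A (Or.inl (Or.inl (Or.inr ⟨i, j, k, rfl⟩)))
  rw [map_sub, map_smul] at h
  exact sub_eq_zero.1 h

theorem hatH_lie_hatF (I : Type) (A : I → I → ℝ) (i j k : I) :
    ⁅hatH I A i j, hatF I A k⁆ = -((if i = j then A i k else 0) • hatF I A k) := by
  have h := hatProj_eq_zero I A (Or.inl (Or.inr ⟨i, j, k, rfl⟩))
  rw [map_add, map_smul] at h
  exact eq_neg_of_add_eq_zero_left h

theorem hatGZero_bracket_d_eq_zero (I : Type) [Countable I] (A : I → I → ℝ)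
    (hC1 : ∀ i j, A i j = A j i)
    (hC2 : ∀ i j, i ≠ j → A i j ≤ 0)
    (hC3 : ∀ i j, 0 < A i i → ∃ m : ℤ, (m : ℝ) = 2 * A i j / A i i)
    (i j k : I) (hij : i ≠ j) (hii : 0 < A i i)
    (n : ℕ) (hn : (n : ℝ) = 1 - 2 * A i j / A i i) :
    ⁅hatE I A k, ((LieAlgebra.ad ℝ (hatGZero I A) (hatF I A i)) ^ n) (hatF I A j)⁆ = 0 ∧
    ⁅hatF I A k, ((LieAlgebra.ad ℝ (hatGZero I A) (hatE I A i)) ^ n) (hatE I A j)⁆ = 0 := by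
  constructor
  · refine lie_ad_pow_eq_zero A (hatE I A) (hatF I A) ?_ ?_ k hij (hC1 i j) (hC2 i j hij) hii n hn
    · intro i j k h
      rw [hatE_lie_hatF, hatH_lie_hatF, if_neg h, zero_smul, neg_zero]
    · intro i k
      rw [hatE_lie_hatF, hatH_lie_hatF, if_pos rfl]
  · refine lie_ad_pow_eq_zero A (hatF I A) (hatE I A) ?_ ?_ k hij (hC1 i j) (hC2 i j hij) hii n hn
    · intro i j k h
      rw [← lie_skew (hatF I A i), hatE_lie_hatF, neg_lie, hatH_lie_hatE, if_neg h.symm, zero_smul,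
        neg_zero]
    · intro i k
      rw [← lie_skew (hatF I A i), hatE_lie_hatF, neg_lie, hatH_lie_hatE, if_pos rfl]
end

section
/- Let g be a real Lie algebra that is ℤ-graded, g = ⨁_{i∈ℤ} g_i, diagonalizable with respect to the abelian subalgebra g_0, equipped with an involution ω mapping g_i onto g_{-i}, and with an invariant symmetric bilinear form (·,·), invariant under ω, such that (g_i, g_j) = 0 for i ≠ -j and the contravariant form (x,y)_0 := -(x, ω(y)) is positive definite on g_m for every m ≠ 0. Then the radical of the form (·,·) is contained in the center of g. -/
/-!
Statement 8: for a ℤ-graded real Lie algebra with abelian `g₀`, diagonalizable with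
respect to `g₀`, with involution `ω` and invariant symmetric `ω`-invariant bilinear form
whose contravariant form is positive definite on the nonzero-degree pieces, the radical
of the form is contained in the center.
-/

theorem radical_subset_center (g : Type) [LieRing g] [LieAlgebra ℝ g]
    (V : ℤ → Submodule ℝ g)
    (hinternal : DirectSum.IsInternal V)
    (hgraded : ∀ (i j : ℤ) (x y : g), x ∈ V i → y ∈ V j → ⁅x, y⁆ ∈ V (i + j))
    -- `g₀` is abelian and `g` is diagonalizable with respect to `g₀`
    (habelian : ∀ x ∈ V 0, ∀ y ∈ V 0, ⁅x, y⁆ = 0)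
    (hdiag : ∃ (ι : Type) (χ : ι → g → ℝ),
      (⨆ s : ι, ⨅ h : V 0,
        Module.End.eigenspace (LieAlgebra.ad ℝ g (h : g)) (χ s (h : g))) = ⊤)
    -- the involution `ω` maps `gᵢ` onto `g₋ᵢ`
    (ω : g ≃ₗ⁅ℝ⁆ g)
    (hω2 : ∀ x, ω (ω x) = x)
    (hωgr : ∀ (i : ℤ) (x : g), x ∈ V i → ω x ∈ V (-i))
    -- the invariant symmetric `ω`-invariant bilinear form
    (B : g →ₗ[ℝ] g →ₗ[ℝ] ℝ)
    (hBsymm : ∀ x y, B x y = B y x)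
    (hBinv : ∀ x y z, B ⁅x, y⁆ z = B x ⁅y, z⁆)
    (hBω : ∀ x y, B (ω x) (ω y) = B x y)
    (hBorth : ∀ (i j : ℤ), i ≠ -j → ∀ x ∈ V i, ∀ y ∈ V j, B x y = 0)
    (hBpos : ∀ m : ℤ, m ≠ 0 → ∀ x ∈ V m, x ≠ 0 → 0 < -(B x (ω x))) :
    -- the radical of the form is contained in the center of `g`
    ∀ k : g, (∀ x : g, B k x = 0) → ∀ y : g, ⁅k, y⁆ = 0 := by
  classical
  intro k hk
  let _ := hinternal.chooseDecomposition
  have eq_zero_of_isotropic : ∀ m : ℤ, m ≠ 0 → ∀ x ∈ V m, B x (ω x) = 0 → x = 0 := by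
    intro m hm x hx h
    by_contra hne
    have := hBpos m hm x hx hne
    linarith
  have hsum := DirectSum.sum_support_decompose V k
  have hcomp : ∀ i : ℤ, ∀ x ∈ V (-i), B (DirectSum.decompose V k i : g) x = 0 := by
    intro i x hx
    have h := hk x
    rw [← hsum, map_sum, LinearMap.sum_apply, Finset.sum_eq_single i] at h
    · exact h
    · intro j _ hji
      exact hBorth j (-i) (by simpa using hji) _ (SetLike.coe_mem _) x hx
    · intro hi
      rw [DFinsupp.notMem_support_iff.mp hi]
      simp
  have hk0 : k ∈ V 0 := by
    rw [← hsum]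
    refine Submodule.sum_mem _ fun i _ => ?_
    by_cases hi : i = 0
    · subst hi
      exact SetLike.coe_mem _
    · rw [eq_zero_of_isotropic i hi _ (SetLike.coe_mem _)
        (hcomp i _ (hωgr i _ (SetLike.coe_mem _)))]
      exact Submodule.zero_mem _
  have hhom : ∀ m : ℤ, ∀ y ∈ V m, ⁅k, y⁆ = 0 := by
    intro m y hy
    by_cases hm : m = 0
    · subst hm
      exact habelian k hk0 y hy
    · refine eq_zero_of_isotropic m hm _ ?_ ?_
      · simpa using hgraded 0 m k y hk0 hy
      · rw [hBinv, hk]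
  intro y
  rw [← DirectSum.sum_support_decompose V y, lie_sum]
  exact Finset.sum_eq_zero fun i _ => hhom i _ (SetLike.coe_mem _)
end

section
/- Let g = ⨁_{i∈ℤ} g_i be a ℤ-graded real Lie algebra with an involution ω mapping g_i onto g_{-i}, and an invariant symmetric bilinear form (·,·), invariant under ω, with (g_i, g_j) = 0 for i ≠ -j and with the contravariant form (x,y)_0 := -(x, ω(y)) positive definite on g_m for every m ≠ 0. Suppose e ∈ g_m and e' ∈ g_n with m, n > 0, put f' = -ω(e') and h' = [e', f'], and assume [e, f'] = 0 and [h', e] = a·e for some a ∈ ℝ. Then ([e,e'], [e,e'])_0 = -a·(e,e)_0; consequently a ≤ 0, and a = 0 if and only if [e,e'] = 0 (provided e ≠ 0). -/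
/-!
Statement 9: the key computation `(⁅e,e'⁆, ⁅e,e'⁆)₀ = -a (e,e)₀` in a graded Lie
algebra with involution and contravariant form, and its consequences `a ≤ 0` and
`a = 0 ↔ ⁅e,e'⁆ = 0` for `e ≠ 0`.
-/

theorem bracket_norm_eq (g : Type) [LieRing g] [LieAlgebra ℝ g]
    (V : ℤ → Submodule ℝ g)
    (hgraded : ∀ (i j : ℤ) (x y : g), x ∈ V i → y ∈ V j → ⁅x, y⁆ ∈ V (i + j))
    -- the involution `ω` maps `gᵢ` onto `g₋ᵢ`
    (ω : g ≃ₗ⁅ℝ⁆ g)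
    (hω2 : ∀ x, ω (ω x) = x)
    (hωgr : ∀ (i : ℤ) (x : g), x ∈ V i → ω x ∈ V (-i))
    -- the invariant symmetric `ω`-invariant bilinear form
    (B : g →ₗ[ℝ] g →ₗ[ℝ] ℝ)
    (hBsymm : ∀ x y, B x y = B y x)
    (hBinv : ∀ x y z, B ⁅x, y⁆ z = B x ⁅y, z⁆)
    (hBω : ∀ x y, B (ω x) (ω y) = B x y)
    (hBorth : ∀ (i j : ℤ), i ≠ -j → ∀ x ∈ V i, ∀ y ∈ V j, B x y = 0)
    (hBpos : ∀ m : ℤ, m ≠ 0 → ∀ x ∈ V m, x ≠ 0 → 0 < -(B x (ω x)))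
    -- the data `e ∈ gₘ`, `e' ∈ gₙ`, `f' = -ω(e')`, `h' = ⁅e',f'⁆`
    (m n : ℤ) (hm : 0 < m) (hn : 0 < n)
    (e e' f' h' : g) (he : e ∈ V m) (he' : e' ∈ V n)
    (hf' : f' = -ω e') (hh' : h' = ⁅e', f'⁆)
    (a : ℝ) (hef' : ⁅e, f'⁆ = 0) (hh'e : ⁅h', e⁆ = a • e) :
    -- `(⁅e,e'⁆, ⁅e,e'⁆)₀ = -a (e,e)₀`
    -(B ⁅e, e'⁆ (ω ⁅e, e'⁆)) = -a * (-(B e (ω e))) ∧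
    -- consequently `a ≤ 0` and `a = 0 ↔ ⁅e,e'⁆ = 0`, provided `e ≠ 0`
    (e ≠ 0 → a ≤ 0 ∧ (a = 0 ↔ ⁅e, e'⁆ = 0)) := by
  have key : -(B ⁅e, e'⁆ (ω ⁅e, e'⁆)) = -a * (-(B e (ω e))) := by
    have hω : ω ⁅e, e'⁆ = ⁅f', ω e⁆ := by
      rw [LieEquiv.map_lie, hf', neg_lie, lie_skew]
    have hbr : ⁅⁅e, e'⁆, f'⁆ = -(a • e) := by
      rw [lie_lie, hef', lie_zero, sub_zero, ← hh', ← hh'e, lie_skew]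
    rw [hω, ← hBinv, hbr]
    simp
  refine ⟨key, fun hne => ?_⟩
  have hpos := hBpos m hm.ne' e he hne
  have hmem : ⁅e, e'⁆ ∈ V (m + n) := hgraded m n e e' he he'
  have hmn : m + n ≠ 0 := (add_pos hm hn).ne'
  by_cases h0 : ⁅e, e'⁆ = 0
  · have ha : a = 0 := by simpa [h0, (neg_pos.mp hpos).ne] using key
    exact ⟨ha.le, fun _ => h0, fun _ => ha⟩
  · have hbpos := hBpos (m + n) hmn _ hmem h0
    rw [key] at hbpos
    have ha : a < 0 := neg_pos.mp (pos_of_mul_pos_left hbpos hpos.le)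
    exact ⟨ha.le, fun h => absurd h ha.ne, fun h => absurd h h0⟩
end
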